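/- arXiv:2111.07160 — 3 statements merged into one kernel-verified Lean document; each statement's English description precedes it below -/
import Mathlib

section
/- Let Δt ≥ 0, Σ_t ≥ 0 and let Σ = diag(σ₁,…,σ_m) ∈ ℝ^{m×m} be diagonal with 0 ≤ σ_k ≤ Σ_t for all k. Let X_c¹, X_L¹ ∈ ℝ^{n×r} and W_L¹, W̃_c¹, W_c¹ ∈ ℝ^{m×r} have orthonormal columns, let S̃_c^‡, S_L¹ ∈ ℝ^{r×r}, and define S̄_c¹ = S̃_c^‡ + Δt·X_c^{1,T}X_L¹S_L¹W_L^{1,T}·Σ·W̃_c¹ and L̃_c¹ = S̄_c¹·W̃_c^{1,T}·(I + ΔtΣ_t·I − Δt·Σ)^{-1}. If S_c¹ ∈ ℝ^{r×r} satisfies S_c¹·W_c^{1,T} = L̃_c¹, then ‖S_c¹‖_F ≤ (max_k 1/(1 + ΔtΣ_t − Δt·σ_k))·‖S̃_c^‡‖_F + (max_k Δt·σ_k/(1 + ΔtΣ_t − Δt·σ_k))·‖S_L¹‖_F. -/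
open Matrix

/-- The Frobenius norm of a real matrix. -/
noncomputable def frobNorm {α β : Type*} [Fintype α] [Fintype β] (A : Matrix α β ℝ) : ℝ :=
  Real.sqrt (∑ i, ∑ j, (A i j) ^ 2)

theorem frob_sq {a b : ℕ} (A : Matrix (Fin a) (Fin b) ℝ) :
    frobNorm A ^ 2 = (A * Aᵀ).trace := by
  unfold frobNorm
  rw [Real.sq_sqrt (by positivity)]
  simp [Matrix.trace, Matrix.mul_apply, sq]

theorem frob_nonneg {a b : ℕ} (A : Matrix (Fin a) (Fin b) ℝ) : 0 ≤ frobNorm A :=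
  Real.sqrt_nonneg _

theorem frob_transpose {a b : ℕ} (A : Matrix (Fin a) (Fin b) ℝ) :
    frobNorm Aᵀ = frobNorm A := by
  unfold frobNorm
  rw [Finset.sum_comm]
  rfl

theorem frob_mul_iso {a b c : ℕ} (A : Matrix (Fin a) (Fin b) ℝ) (W : Matrix (Fin c) (Fin b) ℝ)
    (h : Wᵀ * W = 1) : frobNorm (A * Wᵀ) = frobNorm A := by
  rw [← sq_eq_sq₀ (frob_nonneg _) (frob_nonneg _), frob_sq, frob_sq]
  rw [Matrix.transpose_mul, Matrix.transpose_transpose, Matrix.mul_assoc, ← Matrix.mul_assoc Wᵀ, h,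
    Matrix.one_mul]

theorem frob_mul_coiso {a b c : ℕ} (A : Matrix (Fin a) (Fin c) ℝ) (W : Matrix (Fin c) (Fin b) ℝ)
    (h : Wᵀ * W = 1) : frobNorm (A * W) ≤ frobNorm A := by
  rw [← sq_le_sq₀ (frob_nonneg _) (frob_nonneg _)]
  have h1 := frob_sq (A - A * W * Wᵀ)
  have h2 : (A - A * W * Wᵀ) * (A - A * W * Wᵀ)ᵀ = A * Aᵀ - (A * W) * (A * W)ᵀ := by
    have h3 : A * W * Wᵀ * (W * (Wᵀ * Aᵀ)) = A * W * (Wᵀ * Aᵀ) := by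
      rw [Matrix.mul_assoc (A * W), ← Matrix.mul_assoc Wᵀ, h, Matrix.one_mul]
    simp only [Matrix.transpose_sub, Matrix.transpose_mul, Matrix.transpose_transpose,
      Matrix.sub_mul, Matrix.mul_sub, h3]
    simp only [Matrix.mul_assoc]
    abel
  rw [h2, Matrix.trace_sub, ← frob_sq, ← frob_sq] at h1
  nlinarith [sq_nonneg (frobNorm (A - A * W * Wᵀ))]

theorem frob_mul_diag {a b : ℕ} (A : Matrix (Fin a) (Fin b) ℝ) (d : Fin b → ℝ) (c : ℝ)
    (hc : 0 ≤ c) (hd : ∀ k, 0 ≤ d k ∧ d k ≤ c) :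
    frobNorm (A * Matrix.diagonal d) ≤ c * frobNorm A := by
  unfold frobNorm
  apply Real.sqrt_le_iff.2
  refine ⟨by positivity, ?_⟩
  rw [mul_pow, Real.sq_sqrt (by positivity), Finset.mul_sum]
  refine Finset.sum_le_sum fun i _ => ?_
  rw [Finset.mul_sum]
  refine Finset.sum_le_sum fun j _ => ?_
  rw [Matrix.mul_diagonal, mul_pow, mul_comm]
  have := pow_le_pow_left₀ (hd j).1 (hd j).2 2
  gcongr

section
attribute [local instance] Matrix.frobeniusNormedAddCommGroup Matrix.frobeniusNormedSpace

theorem frob_eq {a b : ℕ} (A : Matrix (Fin a) (Fin b) ℝ) : frobNorm A = ‖A‖ := by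
  rw [Matrix.frobenius_norm_def, frobNorm, Real.sqrt_eq_rpow]
  simp

theorem frob_add_smul {a b : ℕ} (A B : Matrix (Fin a) (Fin b) ℝ) (t : ℝ) (ht : 0 ≤ t) :
    frobNorm (A + t • B) ≤ frobNorm A + t * frobNorm B := by
  simp only [frob_eq]
  refine (norm_add_le _ _).trans ?_
  rw [norm_smul, Real.norm_of_nonneg ht]
end

/-- Norm inequality for the implicit Euler scattering update of the collided flux
(final L-step of the matrix projector–splitting integrator):
`‖S_c¹‖_F ≤ max_k (1/(1+ΔtΣ_t−Δtσ_k))·‖S̃_c^‡‖_F + max_k (Δtσ_k/(1+ΔtΣ_t−Δtσ_k))·‖S_L¹‖_F`. -/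
theorem collided_scattering_update_bound {n m r : ℕ} (hm : 0 < m)
    (Δt St : ℝ) (hΔt : 0 ≤ Δt) (hSt : 0 ≤ St)
    (σ : Fin m → ℝ) (hσ : ∀ k, 0 ≤ σ k ∧ σ k ≤ St)
    (Xc1 XL1 : Matrix (Fin n) (Fin r) ℝ)
    (WL1 Wtc1 Wc1 : Matrix (Fin m) (Fin r) ℝ)
    (hXc1 : Xc1ᵀ * Xc1 = 1) (hXL1 : XL1ᵀ * XL1 = 1)
    (hWL1 : WL1ᵀ * WL1 = 1) (hWtc1 : Wtc1ᵀ * Wtc1 = 1) (hWc1 : Wc1ᵀ * Wc1 = 1)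
    (Stc Sl1 : Matrix (Fin r) (Fin r) ℝ)
    (Sbc1 Sc1 : Matrix (Fin r) (Fin r) ℝ)
    (hSbc1 : Sbc1 = Stc + Δt • (Xc1ᵀ * XL1 * Sl1 * WL1ᵀ * Matrix.diagonal σ * Wtc1))
    (hSc1 : Sc1 * Wc1ᵀ = Sbc1 * Wtc1ᵀ *
      ((1 : Matrix (Fin m) (Fin m) ℝ) + (Δt * St) • (1 : Matrix (Fin m) (Fin m) ℝ)
        - Δt • Matrix.diagonal σ)⁻¹) :
    frobNorm Sc1 ≤ (⨆ k : Fin m, 1 / (1 + Δt * St - Δt * σ k)) * frobNorm Stc +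
      (⨆ k : Fin m, Δt * σ k / (1 + Δt * St - Δt * σ k)) * frobNorm Sl1 := by
  haveI : Nonempty (Fin m) := ⟨⟨0, hm⟩⟩
  obtain ⟨k0, hk0⟩ := Finite.exists_max σ
  have hpos : ∀ k, 0 < 1 + Δt * St - Δt * σ k := fun k => by
    have := mul_le_mul_of_nonneg_left (hσ k).2 hΔt
    linarith
  set g : ℝ := 1 / (1 + Δt * St - Δt * σ k0) with hg
  have hg0 : 0 ≤ g := (one_div_pos.2 (hpos k0)).le
  have hinv : ((1 : Matrix (Fin m) (Fin m) ℝ) + (Δt * St) • (1 : Matrix (Fin m) (Fin m) ℝ)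
        - Δt • Matrix.diagonal σ)⁻¹ =
      Matrix.diagonal (fun k => 1 / (1 + Δt * St - Δt * σ k)) := by
    have e : ((1 : Matrix (Fin m) (Fin m) ℝ) + (Δt * St) • (1 : Matrix (Fin m) (Fin m) ℝ)
        - Δt • Matrix.diagonal σ) = Matrix.diagonal (fun k => 1 + Δt * St - Δt * σ k) := by
      ext i j
      by_cases hij : i = j
      · subst hij; simp
      · simp [hij]
    rw [e]
    apply Matrix.inv_eq_right_inv
    rw [Matrix.diagonal_mul_diagonal, ← Matrix.diagonal_one]
    congr 1
    funext k
    exact mul_one_div_cancel (hpos k).ne'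
  rw [hinv] at hSc1
  have h1 : frobNorm Sc1 ≤ g * frobNorm Sbc1 := by
    rw [← frob_mul_iso Sc1 Wc1 hWc1, hSc1, ← frob_mul_iso Sbc1 Wtc1 hWtc1]
    refine frob_mul_diag _ _ _ hg0 fun k => ⟨(one_div_pos.2 (hpos k)).le, ?_⟩
    have := mul_le_mul_of_nonneg_left (hk0 k) hΔt
    exact one_div_le_one_div_of_le (hpos k0) (by linarith)
  have h2 : frobNorm (Xc1ᵀ * XL1 * Sl1 * WL1ᵀ * Matrix.diagonal σ * Wtc1)
      ≤ σ k0 * frobNorm Sl1 := by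
    refine (frob_mul_coiso _ _ hWtc1).trans ?_
    refine (frob_mul_diag _ _ (σ k0) (hσ k0).1 fun k => ⟨(hσ k).1, hk0 k⟩).trans ?_
    refine mul_le_mul_of_nonneg_left ?_ (hσ k0).1
    rw [frob_mul_iso _ _ hWL1, ← frob_transpose, Matrix.mul_assoc, Matrix.transpose_mul,
      Matrix.transpose_transpose]
    refine (frob_mul_coiso _ _ hXc1).trans ?_
    rw [Matrix.transpose_mul, frob_mul_iso _ _ hXL1, frob_transpose]
  have h3 : frobNorm Sbc1 ≤ frobNorm Stc + Δt * (σ k0 * frobNorm Sl1) := by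
    rw [hSbc1]
    exact (frob_add_smul _ _ _ hΔt).trans
      (add_le_add le_rfl (mul_le_mul_of_nonneg_left h2 hΔt))
  have h4 : g ≤ ⨆ k : Fin m, 1 / (1 + Δt * St - Δt * σ k) :=
    le_ciSup (f := fun k : Fin m => 1 / (1 + Δt * St - Δt * σ k)) (Set.finite_range _).bddAbove k0
  have h5 : g * (Δt * σ k0) ≤ ⨆ k : Fin m, Δt * σ k / (1 + Δt * St - Δt * σ k) := by
    have e : g * (Δt * σ k0) = Δt * σ k0 / (1 + Δt * St - Δt * σ k0) := by
      rw [hg, one_div_mul_eq_div]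
    rw [e]
    exact le_ciSup (f := fun k : Fin m => Δt * σ k / (1 + Δt * St - Δt * σ k))
      (Set.finite_range _).bddAbove k0
  calc frobNorm Sc1 ≤ g * (frobNorm Stc + Δt * (σ k0 * frobNorm Sl1)) :=
        h1.trans (mul_le_mul_of_nonneg_left h3 hg0)
    _ = g * frobNorm Stc + g * (Δt * σ k0) * frobNorm Sl1 := by ring
    _ ≤ _ := add_le_add (mul_le_mul_of_nonneg_right h4 (frob_nonneg _))
        (mul_le_mul_of_nonneg_right h5 (frob_nonneg _))
end

section
/- Let Δt ≥ 0, Σ_t ≥ 0 and 0 ≤ σ ≤ Σ_t be real numbers, let L ≥ 1, and let ψ⁰, ψ¹ and s_ℓ⁰, s_ℓ¹ (ℓ = 1,…,L) and s_c⁰, s_c¹ be nonnegative real numbers satisfying: ψ¹ = ψ⁰/(1 + ΔtΣ_t); s₁¹ ≤ (s₁⁰ + Δt·σ·ψ¹)/(1 + ΔtΣ_t); s_ℓ¹ ≤ (s_ℓ⁰ + Δt·σ·s_{ℓ−1}¹)/(1 + ΔtΣ_t) for ℓ = 2,…,L; and s_c¹ ≤ (s_c⁰ + Δt·σ·s_L¹)/(1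 + ΔtΣ_t − Δt·σ). Then s_c¹ + Σ_{ℓ=1}^{L} s_ℓ¹ + ψ¹ ≤ s_c⁰ + Σ_{ℓ=1}^{L} s_ℓ⁰ + ψ⁰. -/
open Finset

/-- Scalar telescoping recursion underlying the L²-stability proof of the collision source
DLRA scheme: with `0 ≤ σ ≤ Σ_t`, `ψ¹ = ψ⁰/(1+ΔtΣ_t)`,
`s₁¹ ≤ (s₁⁰ + Δtσψ¹)/(1+ΔtΣ_t)`, `s_ℓ¹ ≤ (s_ℓ⁰ + Δtσs_{ℓ−1}¹)/(1+ΔtΣ_t)` for `ℓ = 2,…,L`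
and `s_c¹ ≤ (s_c⁰ + Δtσs_L¹)/(1+ΔtΣ_t−Δtσ)`, one has
`s_c¹ + Σ_ℓ s_ℓ¹ + ψ¹ ≤ s_c⁰ + Σ_ℓ s_ℓ⁰ + ψ⁰`. -/
theorem scalar_telescoping_stability
    (Δt St σ : ℝ) (hΔt : 0 ≤ Δt) (hSt : 0 ≤ St) (hσ0 : 0 ≤ σ) (hσ : σ ≤ St)
    (L : ℕ) (hL : 1 ≤ L)
    (ψ0 ψ1 sc0 sc1 : ℝ) (s0 s1 : ℕ → ℝ)
    (hψ0 : 0 ≤ ψ0) (hψ1 : 0 ≤ ψ1) (hsc0 : 0 ≤ sc0) (hsc1 : 0 ≤ sc1)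
    (hs0 : ∀ ℓ ∈ Finset.Icc 1 L, 0 ≤ s0 ℓ) (hs1 : ∀ ℓ ∈ Finset.Icc 1 L, 0 ≤ s1 ℓ)
    (hψ : ψ1 = ψ0 / (1 + Δt * St))
    (h1 : s1 1 ≤ (s0 1 + Δt * σ * ψ1) / (1 + Δt * St))
    (hrec : ∀ ℓ, 2 ≤ ℓ → ℓ ≤ L → s1 ℓ ≤ (s0 ℓ + Δt * σ * s1 (ℓ - 1)) / (1 + Δt * St))
    (hc : sc1 ≤ (sc0 + Δt * σ * s1 L) / (1 + Δt * St - Δt * σ)) :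
    sc1 + ∑ ℓ ∈ Finset.Icc 1 L, s1 ℓ + ψ1 ≤ sc0 + ∑ ℓ ∈ Finset.Icc 1 L, s0 ℓ + ψ0 := by
  have hab : Δt * σ ≤ Δt * St := mul_le_mul_of_nonneg_left hσ hΔt
  have ha : 0 ≤ Δt * σ := mul_nonneg hΔt hσ0
  generalize Δt * σ = a at *
  generalize Δt * St = b at *
  have hb : 0 < 1 + b := by linarith
  have hcd : 0 < 1 + b - a := by linarith
  rw [le_div_iff₀ hcd] at hc
  rw [le_div_iff₀ hb] at h1
  rw [eq_div_iff hb.ne'] at hψ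
  have key : ∀ n, 1 ≤ n → n ≤ L →
      ∑ ℓ ∈ Finset.Icc 1 n, s1 ℓ + ψ1 + a * s1 n ≤ ∑ ℓ ∈ Finset.Icc 1 n, s0 ℓ + ψ0 := by
    intro n hn
    induction n, hn using Nat.le_induction with
    | base =>
      intro h
      have h2 := hs1 1 (by simp [hL])
      simp only [Finset.Icc_self, Finset.sum_singleton]
      nlinarith [mul_nonneg (sub_nonneg.2 hab) h2, mul_nonneg (sub_nonneg.2 hab) hψ1]
    | succ n hn ih =>
      intro h
      have h2 := hs1 (n + 1) (by simp [h])
      have h3 := hrec (n + 1) (by omega) h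
      rw [le_div_iff₀ hb, Nat.add_sub_cancel] at h3
      rw [Finset.sum_Icc_succ_top (by omega), Finset.sum_Icc_succ_top (by omega)]
      have h4 := ih (by omega)
      nlinarith [mul_nonneg (sub_nonneg.2 hab) h2]
  have h5 := key L hL le_rfl
  nlinarith [mul_nonneg (sub_nonneg.2 hab) hsc1]
end

section
/- (Theorem 2, L²-stability of the full collision source DLRA scheme.) Let Δt ≥ 0, Σ_t ≥ 0, and let Σ = diag(σ₁,…,σ_m) ∈ ℝ^{m×m} be diagonal with 0 ≤ σ_k ≤ Σ_t for all k (so the scattering CFL condition max_k 1/(1+ΔtΣ_t−Δtσ_k) ≤ 1 holds). Let L ≥ 1 and suppose: (i) ψ⁰, ψ¹ ∈ ℝ^{n×n_q} satisfy ‖ψ¹‖_F = ‖ψ⁰‖_F/(1 + ΔtΣ_t) (implicit Euler for the uncollided flux); (ii) T_M ∈ ℝ^{n_q×m} has spectral norm ‖T_M‖ ≤ 1; (iii) for each level ℓ ∈ {1,…,L,c} the post-streaming coefficient matrix S̃_ℓ^‡ ∈ ℝ^{r_ℓ×r_ℓ} satisfies ‖S̃_ℓ^‡‖_F ≤ ‖S_ℓ⁰‖_F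 (guaranteed by the streaming CFL condition via the streaming stability theorem); (iv) the matrices X_ℓ¹ ∈ ℝ^{n×r_ℓ}, W_ℓ¹ ∈ ℝ^{m×r_ℓ} for ℓ ∈ {1,…,L,c} and W̃_c¹ ∈ ℝ^{m×r_c} all have orthonormal columns, and the implicit Euler scattering updates hold: S₁¹ = (1+ΔtΣ_t)^{-1}(S̃₁^‡ + Δt·X₁^{1,T}ψ¹T_MΣW₁¹); S_ℓ¹ = (1+ΔtΣ_t)^{-1}(S̃_ℓ^‡ + Δt·X_ℓ^{1,T}X_{ℓ−1}¹S_{ℓ−1}¹W_{ℓ−1}^{1,T}ΣW_ℓ¹) for ℓ = 2,…,L; S̄_c¹ = S̃_c^‡ + Δt·X_c^{1,T}X_L¹S_L¹W_L^{1,T}ΣW̃_c¹; and S_c¹·W_c^{1,T} = S̄_c¹·W̃_c^{1,T}·(I + ΔtΣ_t·I − Δt·Σ)^{-1} with W_c¹ having orthonormal columns. Then ‖S_c¹‖_F + Σ_{ℓ=1}^{L} ‖S_ℓ¹‖_F + ‖ψ¹‖_F ≤ ‖S_c⁰‖_F + Σ_{ℓ=1}^{L} ‖S_ℓ⁰‖_F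 + ‖ψ⁰‖_F. -/
open Matrix Finset

/-- The spectral norm (largest singular value) of a real matrix. -/
noncomputable def specNormR {p q : ℕ} (A : Matrix (Fin p) (Fin q) ℝ) : ℝ :=
  ‖LinearMap.toContinuousLinearMap (Matrix.toEuclideanLin A)‖

open scoped Matrix.Norms.L2Operator in
theorem specNormR_eq {p q : ℕ} (A : Matrix (Fin p) (Fin q) ℝ) : specNormR A = ‖A‖ := rfl

theorem frob_eq_s12 {α β : Type*} [Fintype α] [Fintype β] (A : Matrix α β ℝ) :
    frobNorm A = ‖WithLp.toLp 2 (fun p : α × β => A p.1 p.2)‖ := by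
  rw [EuclideanSpace.norm_eq, frobNorm, Fintype.sum_prod_type]
  simp

theorem frob_nonneg_s12 {α β : Type*} [Fintype α] [Fintype β] (A : Matrix α β ℝ) :
    0 ≤ frobNorm A := Real.sqrt_nonneg _

theorem frob_add {α β : Type*} [Fintype α] [Fintype β] (A B : Matrix α β ℝ) :
    frobNorm (A + B) ≤ frobNorm A + frobNorm B := by
  rw [frob_eq_s12, frob_eq_s12, frob_eq_s12]
  have h := norm_add_le (WithLp.toLp 2 (fun p : α × β => A p.1 p.2))
    (WithLp.toLp 2 (fun p : α × β => B p.1 p.2))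
  rw [← WithLp.toLp_add] at h
  exact h

theorem frob_smul {α β : Type*} [Fintype α] [Fintype β] (c : ℝ) (hc : 0 ≤ c)
    (A : Matrix α β ℝ) : frobNorm (c • A) = c * frobNorm A := by
  rw [frob_eq_s12, frob_eq_s12]
  have := norm_smul c (WithLp.toLp 2 (fun p : α × β => A p.1 p.2))
  rw [Real.norm_of_nonneg hc] at this
  exact this

theorem frob_transpose_s12 {α β : Type*} [Fintype α] [Fintype β] (A : Matrix α β ℝ) :
    frobNorm Aᵀ = frobNorm A := by
  rw [frobNorm, frobNorm, Finset.sum_comm]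
  rfl

open scoped Matrix.Norms.L2Operator in
theorem frob_mul_left {p q s : ℕ} (A : Matrix (Fin p) (Fin q) ℝ)
    (B : Matrix (Fin q) (Fin s) ℝ) (c : ℝ) (hc : specNormR A ≤ c) :
    frobNorm (A * B) ≤ c * frobNorm B := by
  rw [specNormR_eq] at hc
  have hc0 : 0 ≤ c := (norm_nonneg _).trans hc
  rw [frobNorm, frobNorm, Finset.sum_comm]
  apply Real.sqrt_le_iff.2 ⟨by positivity, ?_⟩
  rw [mul_pow, Real.sq_sqrt (by positivity)]
  rw [Finset.sum_comm (f := fun i j => B i j ^ 2), Finset.mul_sum]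
  refine Finset.sum_le_sum fun j _ => ?_
  have h := Matrix.l2_opNorm_mulVec A (WithLp.toLp 2 (fun i => B i j))
  have h2 := h.trans (mul_le_mul_of_nonneg_right hc (norm_nonneg _))
  have h3 := pow_le_pow_left₀ (norm_nonneg _) h2 2
  rw [mul_pow, EuclideanSpace.norm_sq_eq, EuclideanSpace.norm_sq_eq] at h3
  simpa [Matrix.mul_apply, Matrix.mulVec, dotProduct] using h3

open scoped Matrix.Norms.L2Operator in
theorem spec_transpose {p q : ℕ} (A : Matrix (Fin p) (Fin q) ℝ) :
    specNormR Aᵀ = specNormR A := by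
  rw [specNormR_eq, specNormR_eq, ← Matrix.l2_opNorm_conjTranspose A,
    Matrix.conjTranspose_eq_transpose_of_trivial]

theorem frob_mul_right {p q s : ℕ} (B : Matrix (Fin p) (Fin q) ℝ)
    (A : Matrix (Fin q) (Fin s) ℝ) (c : ℝ) (hc : specNormR A ≤ c) :
    frobNorm (B * A) ≤ c * frobNorm B := by
  rw [← frob_transpose_s12, Matrix.transpose_mul, ← frob_transpose_s12 B]
  exact frob_mul_left _ _ _ (by rwa [spec_transpose])

open scoped Matrix.Norms.L2Operator in
theorem spec_diag {p : ℕ} (d : Fin p → ℝ) (c : ℝ) (hc : 0 ≤ c)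
    (h : ∀ k, 0 ≤ d k ∧ d k ≤ c) : specNormR (Matrix.diagonal d) ≤ c := by
  rw [specNormR_eq, Matrix.l2_opNorm_diagonal, pi_norm_le_iff_of_nonneg hc]
  intro k
  rw [Real.norm_of_nonneg (h k).1]
  exact (h k).2

open scoped Matrix.Norms.L2Operator in
theorem spec_orth {p q : ℕ} (W : Matrix (Fin p) (Fin q) ℝ) (h : Wᵀ * W = 1) :
    specNormR W ≤ 1 := by
  have h1 := Matrix.l2_opNorm_conjTranspose_mul_self W
  rw [Matrix.conjTranspose_eq_transpose_of_trivial, h] at h1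
  have h2 : specNormR (1 : Matrix (Fin q) (Fin q) ℝ) ≤ 1 := by
    rw [← Matrix.diagonal_one]
    exact spec_diag _ 1 zero_le_one (fun k => by simp)
  rw [specNormR_eq] at h2 ⊢
  nlinarith [norm_nonneg W]

theorem frob_src {n m a b : ℕ} (X : Matrix (Fin n) (Fin a) ℝ) (W : Matrix (Fin m) (Fin b) ℝ)
    (hX : Xᵀ * X = 1) (hW : Wᵀ * W = 1) (σ : Fin m → ℝ) (St : ℝ) (hSt : 0 ≤ St)
    (hσ : ∀ k, 0 ≤ σ k ∧ σ k ≤ St) (U : Matrix (Fin n) (Fin m) ℝ) :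
    frobNorm (Xᵀ * U * Matrix.diagonal σ * W) ≤ St * frobNorm U := by
  have h1 := frob_mul_right (Xᵀ * U * Matrix.diagonal σ) W 1 (spec_orth W hW)
  have h2 := frob_mul_right (Xᵀ * U) (Matrix.diagonal σ) St (spec_diag σ St hSt hσ)
  have h3 := frob_mul_left Xᵀ U 1 (by rw [spec_transpose]; exact spec_orth X hX)
  nlinarith [mul_le_mul_of_nonneg_left h3 hSt]

theorem frob_XSW {n m a b : ℕ} (X : Matrix (Fin n) (Fin a) ℝ) (W : Matrix (Fin m) (Fin b) ℝ)
    (hX : Xᵀ * X = 1) (hW : Wᵀ * W = 1) (S : Matrix (Fin a) (Fin b) ℝ) :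
    frobNorm (X * S * Wᵀ) ≤ frobNorm S := by
  have h1 := frob_mul_right (X * S) Wᵀ 1 (by rw [spec_transpose]; exact spec_orth W hW)
  have h2 := frob_mul_left X S 1 (spec_orth X hX)
  linarith

theorem sum_bound (k : ℝ) (hk : 0 ≤ k) (s s0 : ℕ → ℝ) (p : ℝ) (L : ℕ) (hL : 1 ≤ L)
    (h1 : (1 + k) * s 1 ≤ s0 1 + k * p)
    (h : ∀ l, 2 ≤ l → l ≤ L → (1 + k) * s l ≤ s0 l + k * s (l - 1)) :
    ∑ l ∈ Finset.Icc 1 L, s l + k * s L ≤ ∑ l ∈ Finset.Icc 1 L, s0 l + k * p := by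
  induction L, hL using Nat.le_induction with
  | base => simp; linarith
  | succ L hL ih =>
    rw [Finset.sum_Icc_succ_top (by omega), Finset.sum_Icc_succ_top (by omega)]
    have := ih (fun l a b => h l a (by omega))
    have h' := h (L + 1) (by omega) le_rfl
    simp only [Nat.add_sub_cancel] at h'
    linarith

/-- **Theorem 2 (L²-stability of the full collision source DLRA scheme).**
Under the scattering CFL condition (implied by `0 ≤ σ_k ≤ Σ_t` and `Δt ≥ 0`) and assuming
the streaming steps are nonexpansive, the implicit Euler scattering updates of the
uncollided, ℓ-times-collided and collided fluxes satisfy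
`‖S_c¹‖_F + Σ_ℓ ‖S_ℓ¹‖_F + ‖ψ¹‖_F ≤ ‖S_c⁰‖_F + Σ_ℓ ‖S_ℓ⁰‖_F + ‖ψ⁰‖_F`. -/
theorem collision_source_DLRA_L2_stable
    {n nq m : ℕ} (hm : 0 < m)
    (Δt St : ℝ) (hΔt : 0 ≤ Δt) (hSt : 0 ≤ St)
    (σ : Fin m → ℝ) (hσ : ∀ k, 0 ≤ σ k ∧ σ k ≤ St)
    (L : ℕ) (hL : 1 ≤ L)
    -- (i) uncollided flux, implicit Euler
    (ψ0 ψ1 : Matrix (Fin n) (Fin nq) ℝ)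
    (hψ : frobNorm ψ1 = frobNorm ψ0 / (1 + Δt * St))
    -- (ii) moment map
    (TM : Matrix (Fin nq) (Fin m) ℝ) (hTM : specNormR TM ≤ 1)
    -- level data: ranks, coefficient matrices and bases for ℓ = 1,…,L
    (r : ℕ → ℕ)
    (S0 Spost S1 : ∀ ℓ : ℕ, Matrix (Fin (r ℓ)) (Fin (r ℓ)) ℝ)
    (X1 : ∀ ℓ : ℕ, Matrix (Fin n) (Fin (r ℓ)) ℝ)
    (W1 : ∀ ℓ : ℕ, Matrix (Fin m) (Fin (r ℓ)) ℝ)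
    -- collided flux data
    (rc : ℕ) (Sc0 Spostc Sbc1 Sc1 : Matrix (Fin rc) (Fin rc) ℝ)
    (Xc1 : Matrix (Fin n) (Fin rc) ℝ) (Wtc1 Wc1 : Matrix (Fin m) (Fin rc) ℝ)
    -- (iii) post-streaming coefficient matrices are nonexpansive
    (hstream : ∀ ℓ ∈ Finset.Icc 1 L, frobNorm (Spost ℓ) ≤ frobNorm (S0 ℓ))
    (hstreamc : frobNorm Spostc ≤ frobNorm Sc0)
    -- (iv) orthonormal bases
    (horth : ∀ ℓ ∈ Finset.Icc 1 L, (X1 ℓ)ᵀ * X1 ℓ = 1 ∧ (W1 ℓ)ᵀ * W1 ℓ = 1)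
    (hXc1 : Xc1ᵀ * Xc1 = 1) (hWtc1 : Wtc1ᵀ * Wtc1 = 1) (hWc1 : Wc1ᵀ * Wc1 = 1)
    -- (iv) implicit Euler scattering updates
    (hupd1 : S1 1 = (1 + Δt * St)⁻¹ •
      (Spost 1 + Δt • ((X1 1)ᵀ * ψ1 * TM * Matrix.diagonal σ * W1 1)))
    (hupd : ∀ ℓ, 2 ≤ ℓ → ℓ ≤ L → S1 ℓ = (1 + Δt * St)⁻¹ •
      (Spost ℓ + Δt •
        ((X1 ℓ)ᵀ * X1 (ℓ - 1) * S1 (ℓ - 1) * (W1 (ℓ - 1))ᵀ * Matrix.diagonal σ * W1 ℓ)))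
    (hSbc1 : Sbc1 = Spostc + Δt •
      (Xc1ᵀ * X1 L * S1 L * (W1 L)ᵀ * Matrix.diagonal σ * Wtc1))
    (hSc1 : Sc1 * Wc1ᵀ = Sbc1 * Wtc1ᵀ *
      ((1 : Matrix (Fin m) (Fin m) ℝ) + (Δt * St) • (1 : Matrix (Fin m) (Fin m) ℝ)
        - Δt • Matrix.diagonal σ)⁻¹) :
    frobNorm Sc1 + ∑ ℓ ∈ Finset.Icc 1 L, frobNorm (S1 ℓ) + frobNorm ψ1 ≤
      frobNorm Sc0 + ∑ ℓ ∈ Finset.Icc 1 L, frobNorm (S0 ℓ) + frobNorm ψ0 := by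
  have hk : 0 ≤ Δt * St := mul_nonneg hΔt hSt
  have ha : 0 < 1 + Δt * St := by linarith
  have hψ' : (1 + Δt * St) * frobNorm ψ1 = frobNorm ψ0 := by
    rw [hψ]; field_simp
  have key : ∀ (q : ℕ) (S P Q : Matrix (Fin q) (Fin q) ℝ) (s0 u : ℝ),
      S = (1 + Δt * St)⁻¹ • (P + Δt • Q) → frobNorm P ≤ s0 → frobNorm Q ≤ St * u →
      (1 + Δt * St) * frobNorm S ≤ s0 + Δt * St * u := by
    intro q S P Q s0 u hS hP hQ
    rw [hS, frob_smul _ (inv_nonneg.2 ha.le), mul_inv_cancel_left₀ ha.ne']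
    have h1 := frob_add P (Δt • Q)
    rw [frob_smul _ hΔt] at h1
    have := mul_le_mul_of_nonneg_left hQ hΔt
    linarith
  have hmain := sum_bound (Δt * St) hk (fun l => frobNorm (S1 l)) (fun l => frobNorm (S0 l))
    (frobNorm ψ1) L hL (by
      have hm1 : 1 ∈ Finset.Icc 1 L := Finset.mem_Icc.2 ⟨le_rfl, hL⟩
      refine key _ _ _ _ _ _ hupd1 (hstream 1 hm1) ?_
      have h1 := frob_src (X1 1) (W1 1) (horth 1 hm1).1 (horth 1 hm1).2 σ St hSt hσ (ψ1 * TM)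
      have h2 := frob_mul_right ψ1 TM 1 hTM
      rw [← Matrix.mul_assoc] at h1
      nlinarith) (by
      intro l h2 hl
      have hm1 : l ∈ Finset.Icc 1 L := Finset.mem_Icc.2 ⟨by omega, hl⟩
      have hm2 : l - 1 ∈ Finset.Icc 1 L := Finset.mem_Icc.2 ⟨by omega, by omega⟩
      refine key _ _ _ _ _ _ (hupd l h2 hl) (hstream l hm1) ?_
      have h1 := frob_src (X1 l) (W1 l) (horth l hm1).1 (horth l hm1).2 σ St hSt hσ
        (X1 (l - 1) * S1 (l - 1) * (W1 (l - 1))ᵀ)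
      have h3 := frob_XSW (X1 (l - 1)) (W1 (l - 1)) (horth _ hm2).1 (horth _ hm2).2 (S1 (l - 1))
      simp only [← Matrix.mul_assoc] at h1 h3
      exact h1.trans (mul_le_mul_of_nonneg_left h3 hSt))
  have hmL : L ∈ Finset.Icc 1 L := Finset.mem_Icc.2 ⟨hL, le_rfl⟩
  have hb : frobNorm Sbc1 ≤ frobNorm Sc0 + Δt * St * frobNorm (S1 L) := by
    have h1 := frob_src Xc1 Wtc1 hXc1 hWtc1 σ St hSt hσ (X1 L * S1 L * (W1 L)ᵀ)
    have h3 := frob_XSW (X1 L) (W1 L) (horth _ hmL).1 (horth _ hmL).2 (S1 L)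
    simp only [← Matrix.mul_assoc] at h1 h3
    have h4 := mul_le_mul_of_nonneg_left (h1.trans (mul_le_mul_of_nonneg_left h3 hSt)) hΔt
    have h5 := frob_add Spostc (Δt •
      (Xc1ᵀ * X1 L * S1 L * (W1 L)ᵀ * Matrix.diagonal σ * Wtc1))
    rw [frob_smul _ hΔt, ← hSbc1] at h5
    linarith
  have hd : ∀ k, 1 ≤ 1 + Δt * St - Δt * σ k := fun k => by
    have := mul_le_mul_of_nonneg_left (hσ k).2 hΔt
    linarith
  have hinv : ((1 : Matrix (Fin m) (Fin m) ℝ) + (Δt * St) • (1 : Matrix (Fin m) (Fin m) ℝ)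
        - Δt • Matrix.diagonal σ)⁻¹ = Matrix.diagonal (fun k => (1 + Δt * St - Δt * σ k)⁻¹) := by
    have he : (1 : Matrix (Fin m) (Fin m) ℝ) + (Δt * St) • (1 : Matrix (Fin m) (Fin m) ℝ)
        - Δt • Matrix.diagonal σ = Matrix.diagonal (fun k => 1 + Δt * St - Δt * σ k) := by
      ext i j
      by_cases hij : i = j
      · subst hij; simp
      · simp [hij]
    rw [he]
    apply Matrix.inv_eq_right_inv
    rw [Matrix.diagonal_mul_diagonal, ← Matrix.diagonal_one]
    congr 1
    funext k
    exact mul_inv_cancel₀ (by linarith [hd k])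
  have hc : frobNorm Sc1 ≤ frobNorm Sbc1 := by
    have e : Sc1 = Sc1 * Wc1ᵀ * Wc1 := by rw [Matrix.mul_assoc, hWc1, Matrix.mul_one]
    have h1 := frob_mul_right (Sc1 * Wc1ᵀ) Wc1 1 (spec_orth _ hWc1)
    rw [← e, hSc1, hinv] at h1
    have h2 := frob_mul_right (Sbc1 * Wtc1ᵀ)
      (Matrix.diagonal (fun k => (1 + Δt * St - Δt * σ k)⁻¹)) 1
      (spec_diag _ 1 zero_le_one fun k =>
        ⟨inv_nonneg.2 (by linarith [hd k]), inv_le_one_of_one_le₀ (hd k)⟩)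
    have h3 := frob_mul_right Sbc1 Wtc1ᵀ 1 (by rw [spec_transpose]; exact spec_orth _ hWtc1)
    linarith
  linarith
end
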